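/- (Beveridge–Nelson decomposition.) Let {C_j}_{j≥0} be n×n real matrices with Σ_{j=0}^∞ (j+1)‖C_j‖ < ∞ for some matrix norm ‖·‖, and define C̃_j = Σ_{k=j+1}^∞ C_k. Then for every complex z with |z| ≤ 1, all the series below converge absolutely and Σ_{j=0}^∞ C_j z^j = (Σ_{j=0}^∞ C_j) − (1−z)·Σ_{j=0}^∞ C̃_j z^j. -/

import Mathlib

/-- A linear functional on a finite-dimensional real space is bounded with respect to any norm,
the norm being given as a bare function. -/
theorem LinearMap.exists_abs_le_mul_of_isNorm {E : Type*} [AddCommGroup E] [Module ℝ E]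
    [FiniteDimensional ℝ E] (N : E → ℝ) (hN0 : ∀ x, 0 ≤ N x)
    (hNadd : ∀ x y, N (x + y) ≤ N x + N y) (hNsmul : ∀ (r : ℝ) (x : E), N (r • x) = |r| * N x)
    (hNdef : ∀ x, N x = 0 → x = 0) (f : E →ₗ[ℝ] ℝ) :
    ∃ K : ℝ, ∀ x, |f x| ≤ K * N x := by
  let _ : Norm E := ⟨N⟩
  have core : NormedSpace.Core ℝ E :=
    { norm_nonneg := hN0
      norm_smul := hNsmul
      norm_triangle := hNadd
      norm_eq_zero_iff := fun x => ⟨hNdef x, by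
        rintro rfl
        have h : N 0 = 0 := by simpa using hNsmul 0 0
        exact h⟩ }
  let _ : NormedAddCommGroup E := NormedAddCommGroup.ofCore core
  let _ : NormedSpace ℝ E := NormedSpace.ofCore core
  exact ⟨‖f.toContinuousLinearMap‖, fun x => f.toContinuousLinearMap.le_opNorm x⟩

section Scalar

variable {𝕜 : Type*} [NormedField 𝕜] {a : ℕ → 𝕜}

theorem summable_norm_of_summable_succ_mul_norm
    (ha : Summable fun j : ℕ => ((j : ℝ) + 1) * ‖a j‖) : Summable fun j => ‖a j‖ :=
  ha.of_nonneg_of_le (fun _ => norm_nonneg _) fun j =>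
    le_mul_of_one_le_left (norm_nonneg _) (by simp)

theorem summable_norm_mul_pow_of_norm_le_one (ha : Summable fun j => ‖a j‖) {z : 𝕜}
    (hz : ‖z‖ ≤ 1) : Summable fun j => ‖a j * z ^ j‖ :=
  ha.of_nonneg_of_le (fun _ => norm_nonneg _) fun j => by
    rw [norm_mul, norm_pow]
    exact mul_le_of_le_one_right (norm_nonneg _) (pow_le_one₀ (norm_nonneg _) hz)

/-- The double series of the tails converges absolutely, each `a (m + 1)` occurring `m + 1` times. -/
theorem summable_prod_norm_tail (ha : Summable fun j : ℕ => ((j : ℝ) + 1) * ‖a j‖) :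
    Summable fun p : ℕ × ℕ => ‖a (p.1 + 1 + p.2)‖ := by
  rw [← (Finset.HasAntidiagonal.sigmaAntidiagonalEquivProd (A := ℕ)).summable_iff]
  have fiber (m : ℕ) (p : Finset.HasAntidiagonal.antidiagonal m) :
      ‖a (p.1.1 + 1 + p.1.2)‖ = ‖a (m + 1)‖ := by
    rw [add_right_comm, Finset.HasAntidiagonal.mem_antidiagonal.mp p.2]
  refine (summable_sigma_of_nonneg fun _ => norm_nonneg _).2
    ⟨fun m => (hasSum_fintype _).summable, ?_⟩
  refine ((summable_nat_add_iff 1).2 ha).of_nonneg_of_le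
    (fun m => tsum_nonneg fun _ => norm_nonneg _) fun m => ?_
  simp only [Finset.HasAntidiagonal.sigmaAntidiagonalEquivProd_apply, fiber, tsum_fintype,
    Finset.sum_const, Finset.card_univ, Fintype.card_coe, Finset.Nat.card_antidiagonal,
    nsmul_eq_mul]
  push_cast
  gcongr
  linarith

theorem summable_norm_tsum_tail (ha : Summable fun j : ℕ => ((j : ℝ) + 1) * ‖a j‖) :
    Summable fun j : ℕ => ‖∑' k, a (j + 1 + k)‖ :=
  (summable_prod_norm_tail ha).prod.of_nonneg_of_le (fun _ => norm_nonneg _) fun j =>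
    norm_tsum_le_tsum_norm ((summable_prod_norm_tail ha).prod_factor j)

/-- The scalar Beveridge–Nelson decomposition. -/
theorem tsum_mul_pow_eq_tsum_sub_one_sub_mul [CompleteSpace 𝕜]
    (ha : Summable fun j : ℕ => ((j : ℝ) + 1) * ‖a j‖) {z : 𝕜} (hz : ‖z‖ ≤ 1) :
    ∑' j, a j * z ^ j = ∑' j, a j - (1 - z) * ∑' j, (∑' k, a (j + 1 + k)) * z ^ j := by
  have ha₁ := summable_norm_of_summable_succ_mul_norm ha
  have haz := (summable_norm_mul_pow_of_norm_le_one ha₁ hz).of_norm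
  have hT := (summable_norm_mul_pow_of_norm_le_one (summable_norm_tsum_tail ha) hz).of_norm
  have tail (j : ℕ) : ∑' k, a (j + 1 + k) = a (j + 1) + ∑' k, a (j + 1 + 1 + k) := by
    have hs : Summable fun k => a (j + 1 + k) :=
      ((summable_prod_norm_tail ha).prod_factor j).of_norm
    rw [hs.tsum_eq_zero_add]
    simp only [add_zero, add_assoc, add_comm 1]
  have total : ∑' j, a j = a 0 + ∑' k, a (0 + 1 + k) := by
    rw [ha₁.of_norm.tsum_eq_zero_add]
    simp only [zero_add, add_comm 1]
  have shift : z * ∑' j, (∑' k, a (j + 1 + k)) * z ^ j =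
      ∑' j, a (j + 1) * z ^ (j + 1) + ∑' j, (∑' k, a (j + 1 + 1 + k)) * z ^ (j + 1) := by
    rw [← ((summable_nat_add_iff 1).2 haz).tsum_add ((summable_nat_add_iff 1).2 hT),
      ← tsum_mul_left]
    refine tsum_congr fun j => ?_
    rw [tail j]
    ring
  have split := hT.tsum_eq_zero_add
  rw [haz.tsum_eq_zero_add, total]
  simp only [pow_zero, mul_one] at split ⊢
  linear_combination split - shift

end Scalar

/-- the Beveridge–Nelson decomposition. If `Σ (j+1)·‖C_j‖ < ∞` for some
matrix norm, then for every `z` in the closed unit disc all the series converge absolutely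
and `Σ C_j z^j = (Σ C_j) − (1−z)·Σ C̃_j z^j`, where `C̃_j = Σ_{k>j} C_k`
(stated entrywise as an identity of complex matrices). -/
theorem statement8 (n : ℕ) (C : ℕ → Matrix (Fin n) (Fin n) ℝ)
    (N : Matrix (Fin n) (Fin n) ℝ → ℝ)
    (hN0 : ∀ A, 0 ≤ N A)
    (hNadd : ∀ A B, N (A + B) ≤ N A + N B)
    (hNsmul : ∀ (r : ℝ) (A : Matrix (Fin n) (Fin n) ℝ), N (r • A) = |r| * N A)
    (hNdef : ∀ A, N A = 0 → A = 0)
    (hsum : Summable fun j : ℕ => ((j : ℝ) + 1) * N (C j)) :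
    ∀ z : ℂ, ‖z‖ ≤ 1 →
      (∀ i i' : Fin n, Summable fun j : ℕ => ‖(C j i i' : ℂ) * z ^ j‖) ∧
      (∀ i i' : Fin n, Summable fun j : ℕ => ‖(C j i i' : ℂ)‖) ∧
      (∀ (i i' : Fin n) (j : ℕ), Summable fun k : ℕ => ‖(C (j + 1 + k) i i' : ℂ)‖) ∧
      (∀ i i' : Fin n,
        Summable fun j : ℕ => ‖(∑' k : ℕ, (C (j + 1 + k) i i' : ℂ)) * z ^ j‖) ∧
      (∀ i i' : Fin n,
        ∑' j : ℕ, (C j i i' : ℂ) * z ^ j =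
          (∑' j : ℕ, (C j i i' : ℂ)) -
            (1 - z) * ∑' j : ℕ, (∑' k : ℕ, (C (j + 1 + k) i i' : ℂ)) * z ^ j) := by
  intro z hz
  have hC (i i' : Fin n) : Summable fun j : ℕ => ((j : ℝ) + 1) * ‖(C j i i' : ℂ)‖ := by
    obtain ⟨K, hK⟩ := (Matrix.entryLinearMap ℝ ℝ i i').exists_abs_le_mul_of_isNorm
      N hN0 hNadd hNsmul hNdef
    refine (hsum.mul_left K).of_nonneg_of_le (fun j => by positivity) fun j => ?_
    rw [Complex.norm_real, Real.norm_eq_abs, mul_left_comm]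
    exact mul_le_mul_of_nonneg_left (hK (C j)) (by positivity)
  exact ⟨fun i i' => summable_norm_mul_pow_of_norm_le_one
      (summable_norm_of_summable_succ_mul_norm (hC i i')) hz,
    fun i i' => summable_norm_of_summable_succ_mul_norm (hC i i'),
    fun i i' j => (summable_prod_norm_tail (hC i i')).prod_factor j,
    fun i i' => summable_norm_mul_pow_of_norm_le_one (summable_norm_tsum_tail (hC i i')) hz,
    fun i i' => tsum_mul_pow_eq_tsum_sub_one_sub_mul (hC i i') hz⟩
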